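/- Let N₀, N₁ be positive integers and let a ∈ ℤ₊^{N₀}, a' ∈ ℤ₊^{N₀N₁} be multi-indices with |a| = |a'| = m. Then the number of permutations σ ∈ S_m satisfying (η_a(n) - 1)·N₁ < η_{a'}(σ(n)) ≤ η_a(n)·N₁ for every n ∈ {1,…,m} equals a! = Π_{i=1}^{N₀} a_i! if a' matches a, and equals 0 otherwise. -/

import Mathlib

open Finset
open scoped Classical

/-- `a' ∈ ℤ₊^{N₀N₁}` matches `a ∈ ℤ₊^{N₀}` if `Σ_{k=1}^{i} a_k = Σ_{k=1}^{iN₁} a'_k`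
for every `i ∈ {1,…,N₀}` (written 0-indexed). -/
def MultiIndexMatches (N₀ N₁ : ℕ) (a : Fin N₀ → ℕ) (a' : Fin (N₀ * N₁) → ℕ) : Prop :=
  ∀ i : Fin N₀,
    ∑ k ∈ Finset.univ.filter (fun k : Fin (N₀ * N₁) => (k : ℕ) < ((i : ℕ) + 1) * N₁), a' k
      = ∑ k ∈ Finset.univ.filter (fun k : Fin N₀ => k ≤ i), a k

/-- `η` is the function `η_a : {1,…,m} → {1,…,ℓ}` of the paper (written 0-indexed), i.e.
`η_a(n) = i` whenever `Σ_{k<i} a_k ≤ n < Σ_{k≤i} a_k`. -/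
def IsEta {ℓ m : ℕ} (a : Fin ℓ → ℕ) (η : Fin m → Fin ℓ) : Prop :=
  ∀ n : Fin m,
    (∑ k ∈ Finset.univ.filter (fun k : Fin ℓ => k < η n), a k) ≤ (n : ℕ) ∧
    (n : ℕ) < ∑ k ∈ Finset.univ.filter (fun k : Fin ℓ => k ≤ η n), a k

/-- Under `IsEta`, membership in an initial segment of blocks is a threshold condition. -/
theorem IsEta.lt_iff {ℓ m : ℕ} {a : Fin ℓ → ℕ} {η : Fin m → Fin ℓ} (h : IsEta a η)
    (t : ℕ) (n : Fin m) :
    (η n : ℕ) < t ↔ (n : ℕ) < ∑ k ∈ Finset.univ.filter (fun k : Fin ℓ => (k : ℕ) < t), a k := by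
  constructor
  · intro ht
    refine (h n).2.trans_le (Finset.sum_le_sum_of_subset fun k hk => ?_)
    simp only [Finset.mem_filter, Finset.mem_univ, true_and, Fin.le_def] at hk ⊢
    omega
  · intro hn
    by_contra! ht
    refine absurd ((h n).1.trans_lt hn) (not_lt.2 (Finset.sum_le_sum_of_subset fun k hk => ?_))
    simp only [Finset.mem_filter, Finset.mem_univ, true_and, Fin.lt_def] at hk ⊢
    omega

/-- The number of points in the first `t` blocks is the sum of the first `t` block sizes. -/
theorem IsEta.card_lt {ℓ m : ℕ} {a : Fin ℓ → ℕ} {η : Fin m → Fin ℓ} (h : IsEta a η)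
    (ha : ∑ i, a i = m) (t : ℕ) :
    (Finset.univ.filter (fun n : Fin m => (η n : ℕ) < t)).card
      = ∑ k ∈ Finset.univ.filter (fun k : Fin ℓ => (k : ℕ) < t), a k := by
  have hle : ∑ k ∈ Finset.univ.filter (fun k : Fin ℓ => (k : ℕ) < t), a k ≤ m :=
    (Finset.sum_le_sum_of_subset (Finset.filter_subset _ _)).trans ha.le
  simp_rw [h.lt_iff]
  rw [Fin.card_filter_val_lt, min_eq_right hle]

/-- The `i`-th block has `a i` points. -/
theorem IsEta.card_fiber {ℓ m : ℕ} {a : Fin ℓ → ℕ} {η : Fin m → Fin ℓ} (h : IsEta a η)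
    (ha : ∑ i, a i = m) (i : Fin ℓ) :
    (Finset.univ.filter (fun n : Fin m => η n = i)).card = a i := by
  have h₁ := h.card_lt ha (i + 1)
  have h₀ := h.card_lt ha i
  have e₁ : Finset.univ.filter (fun n : Fin m => (η n : ℕ) < i + 1)
      = Finset.univ.filter (fun n : Fin m => (η n : ℕ) < i)
        ∪ Finset.univ.filter (fun n : Fin m => η n = i) := by
    ext n
    simp only [Finset.mem_union, Finset.mem_filter, Finset.mem_univ, true_and, Fin.ext_iff]
    omega
  have e₂ : Finset.univ.filter (fun k : Fin ℓ => (k : ℕ) < i + 1)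
      = insert i (Finset.univ.filter (fun k : Fin ℓ => (k : ℕ) < i)) := by
    ext k
    simp only [Finset.mem_insert, Finset.mem_filter, Finset.mem_univ, true_and, Fin.ext_iff]
    omega
  rw [e₁, Finset.card_union_of_disjoint, e₂, Finset.sum_insert (by simp)] at h₁
  · omega
  · refine Finset.disjoint_left.2 fun n hn hn' => ?_
    simp only [Finset.mem_filter, Finset.mem_univ, true_and] at hn hn'
    simp [hn'] at hn

/-- The number of permutations preserving every fiber of `f` is the product of the factorials of
the fiber cardinalities. -/
theorem card_filter_perm_comp_eq {α ι : Type*} [Fintype α] [Fintype ι] [DecidableEq α]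
    [DecidableEq ι] (f : α → ι) :
    (Finset.univ.filter (fun σ : Equiv.Perm α => f ∘ σ = f)).card
      = ∏ i, Nat.factorial (Finset.univ.filter (fun x => f x = i)).card := by
  simpa [Fintype.card_subtype] using DomMulAct.stabilizer_card f

/-- For multi-indices `a ∈ ℤ₊^{N₀}`, `a' ∈ ℤ₊^{N₀N₁}` with `|a| = |a'| = m`,
the number of permutations `σ ∈ S_m` with `(η_a(n)-1)N₁ < η_{a'}(σ(n)) ≤ η_a(n)N₁`
(0-indexed: `η_a(n)·N₁ ≤ η_{a'}(σ(n)) < (η_a(n)+1)·N₁`) for all `n` is `a!` if `a'`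
matches `a`, and `0` otherwise. -/
theorem card_perm_matching_blocks (N₀ N₁ m : ℕ) (hN₀ : 0 < N₀) (hN₁ : 0 < N₁)
    (a : Fin N₀ → ℕ) (a' : Fin (N₀ * N₁) → ℕ)
    (ha : ∑ i, a i = m) (ha' : ∑ j, a' j = m)
    (η : Fin m → Fin N₀) (η' : Fin m → Fin (N₀ * N₁))
    (hη : IsEta a η) (hη' : IsEta a' η') :
    (Finset.univ.filter (fun σ : Equiv.Perm (Fin m) =>
        ∀ n : Fin m, (η n : ℕ) * N₁ ≤ (η' (σ n) : ℕ) ∧ (η' (σ n) : ℕ) < ((η n : ℕ) + 1) * N₁)).card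
      = if MultiIndexMatches N₀ N₁ a a' then ∏ i, Nat.factorial (a i) else 0 := by
  have hη_le (n : Fin m) (i : Fin N₀) :
      η n ≤ i ↔ (n : ℕ) < ∑ k ∈ Finset.univ.filter (fun k : Fin N₀ => k ≤ i), a k := by
    simpa only [Nat.lt_succ_iff, Fin.le_def] using hη.lt_iff (i + 1) n
  split_ifs with hm
  · have hdiv (n : Fin m) : (η' n : ℕ) / N₁ = η n := by
      have hlt : (η' n : ℕ) / N₁ < N₀ :=
        Nat.div_lt_of_lt_mul (by simpa only [mul_comm] using (η' n).isLt)
      have key (i : Fin N₀) : (η' n : ℕ) / N₁ ≤ i ↔ (η n : ℕ) ≤ i := by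
        rw [← Nat.lt_succ_iff, Nat.div_lt_iff_lt_mul hN₁, Nat.succ_eq_add_one, hη'.lt_iff, hm i,
          ← hη_le, Fin.le_def]
      exact le_antisymm ((key (η n)).2 le_rfl) ((key ⟨_, hlt⟩).1 le_rfl)
    trans (Finset.univ.filter (fun σ : Equiv.Perm (Fin m) => η ∘ σ = η)).card
    · congr 1
      ext σ
      simp only [Finset.mem_filter, Finset.mem_univ, true_and, funext_iff, Function.comp_apply,
        Fin.ext_iff, ← hdiv (σ _)]
      refine forall_congr' fun n => ?_
      rw [← Nat.le_div_iff_mul_le hN₁, ← Nat.div_lt_iff_lt_mul hN₁]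
      omega
    · rw [card_filter_perm_comp_eq]
      refine Finset.prod_congr rfl fun i _ => ?_
      rw [hη.card_fiber ha i]
  · rw [Finset.card_eq_zero, Finset.filter_eq_empty_iff]
    intro σ _ hσ
    refine hm fun i => ?_
    have hcard := hη.card_lt ha (i + 1)
    simp only [Nat.lt_succ_iff, ← Fin.le_def] at hcard
    rw [← hη'.card_lt ha', ← hcard]
    symm
    refine Finset.card_equiv σ fun n => ?_
    simp only [Finset.mem_filter, Finset.mem_univ, true_and, Fin.le_def]
    have h₁ := (Nat.le_div_iff_mul_le hN₁).2 (hσ n).1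
    have h₂ := (Nat.div_lt_iff_lt_mul hN₁).2 (hσ n).2
    rw [← Nat.div_lt_iff_lt_mul hN₁]
    omega
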